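/- For any dimension d and transition DFT matrix between bases A and B, the set of KD-real self-adjoint operators (operators F with ⟨a_i|F|b_j⟩⟨b_j|a_i⟩ ∈ ℝ for all i,j) coincides with the real linear span of the KD-classical pure-state projections: KD^r_{A,B} = span_ℝ(pure(KD^+_{A,B})). -/

import Mathlib

open Finset Complex
open scoped ComplexOrder

/-- ω_n = e^{2πi/n} -/
noncomputable def ww (n : ℕ) : ℂ := Complex.exp (2 * Real.pi * Complex.I / n)

/-- |ψ_{m,s}⟩ = (1/√x) ∑_{k<x} ω_x^{sk} |a_{ky+m}⟩ in ℂ^d (standard basis coords). -/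
noncomputable def psi (d x y m s : ℕ) : Fin d → ℂ :=
  fun t => (1 / Real.sqrt x) *
    ∑ k ∈ Finset.range x, ww x ^ (s * k) * (if (t : ℕ) = k * y + m then 1 else 0)

/-- Fourier basis vector |b_j⟩, coordinates in the standard basis. -/
noncomputable def bvec (d j : ℕ) : Fin d → ℂ :=
  fun i => ww d ^ ((i : ℕ) * j) / Real.sqrt d

/-- rank one projection |v⟩⟨v| as a matrix. -/
noncomputable def proj {d : ℕ} (v : Fin d → ℂ) : Matrix (Fin d) (Fin d) ℂ :=
  fun i j => v i * (starRingEnd ℂ) (v j)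

/-- KD quasiprobability Q_{ij}(ρ) = ⟨a_i|ρ|b_j⟩⟨b_j|a_i⟩ (standard/Fourier bases). -/
noncomputable def KD {d : ℕ} (ρ : Matrix (Fin d) (Fin d) ℂ) (i j : Fin d) : ℂ :=
  (∑ l, ρ i l * bvec d (j : ℕ) l) * (starRingEnd ℂ) (bvec d (j : ℕ) i)

/-- The set of KD-classical pure-state projections for the DFT pair in dimension d. -/
def pureKD (d : ℕ) : Set (Matrix (Fin d) (Fin d) ℂ) :=
  {M | ∃ x y m s : ℕ, x * y = d ∧ m < y ∧ s < x ∧ M = proj (psi d x y m s)}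

/-- The reduction `Fin d → ZMod d` as an equivalence. -/
def finZMod (d : ℕ) [NeZero d] : Fin d ≃ ZMod d where
  toFun t := ((t : ℕ) : ZMod d)
  invFun a := ⟨a.val, ZMod.val_lt a⟩
  left_inv t := by ext; simp [ZMod.val_natCast, Nat.mod_eq_of_lt t.isLt]
  right_inv a := by simp

theorem finZMod_apply (d : ℕ) [NeZero d] (t : Fin d) : finZMod d t = ((t : ℕ) : ZMod d) := rfl

theorem ww_pow (d : ℕ) [NeZero d] (n : ℕ) : ww d ^ n = ZMod.stdAddChar (n : ZMod d) := by
  have h := ZMod.stdAddChar_coe (N := d) (n : ℤ)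
  rw [Int.cast_natCast] at h
  rw [h, ww, ← Complex.exp_nat_mul]
  congr 1
  push_cast
  ring

theorem ww_pow_of_mul_eq {d x y : ℕ} [NeZero d] (hxy : x * y = d) (n : ℕ) :
    ww x ^ n = ZMod.stdAddChar ((n * y : ℕ) : ZMod d) := by
  have hd : d ≠ 0 := NeZero.ne d
  have hx : (x : ℂ) ≠ 0 := by rintro h; simp_all
  have hy : (y : ℂ) ≠ 0 := by rintro h; simp_all
  rw [← ww_pow, ww, ww, ← Complex.exp_nat_mul, ← Complex.exp_nat_mul]
  congr 1
  subst hxy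
  push_cast
  field_simp

theorem conj_stdAddChar {d : ℕ} [NeZero d] (a : ZMod d) :
    (starRingEnd ℂ) (ZMod.stdAddChar a) = ZMod.stdAddChar (-a) :=
  (AddChar.map_neg_eq_conj _ _).symm

theorem psi_apply {d x y m : ℕ} [NeZero d] (hxy : x * y = d) (hm : m < y) (s : ℕ) (t : Fin d) :
    psi d x y m s t = if (t : ℕ) % y = m then
      (1 / Real.sqrt x) * ZMod.stdAddChar ((s : ZMod d) * (finZMod d t - (m : ZMod d))) else 0 := by
  unfold psi
  split_ifs with h
  · have ht : (t : ℕ) = (t : ℕ) / y * y + m := by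
      rw [← h, mul_comm]; exact (Nat.div_add_mod _ _).symm
    have hlt : (t : ℕ) / y < x := by
      rw [Nat.div_lt_iff_lt_mul (by omega), hxy]; exact t.isLt
    congr 1
    rw [Finset.sum_eq_single ((t : ℕ) / y)]
    · rw [if_pos ht, mul_one, ww_pow_of_mul_eq hxy, finZMod_apply]
      congr 1
      conv_rhs => rw [ht]
      push_cast
      ring
    · intro k _ hk
      rw [if_neg, mul_zero]
      intro h'
      apply hk
      rw [h', mul_comm k, Nat.mul_add_div (by omega), Nat.div_eq_of_lt hm, add_zero]
    · intro h'
      exact absurd (Finset.mem_range.2 hlt) h'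
  · rw [Finset.sum_eq_zero, mul_zero]
    intro k _
    rw [if_neg, mul_zero]
    intro h'
    apply h
    rw [h', Nat.mul_add_mod_self_right, Nat.mod_eq_of_lt hm]

theorem proj_psi_apply {d x y m : ℕ} [NeZero d] (hxy : x * y = d) (hm : m < y) (s : ℕ)
    (t u : Fin d) :
    proj (psi d x y m s) t u = if (t : ℕ) % y = m ∧ (u : ℕ) % y = m then
      (1 / x : ℂ) * ZMod.stdAddChar ((s : ZMod d) * (finZMod d t - finZMod d u)) else 0 := by
  unfold proj
  rw [psi_apply hxy hm, psi_apply hxy hm]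
  by_cases ht : (t : ℕ) % y = m <;> by_cases hu : (u : ℕ) % y = m <;> simp only [ht, hu, if_true,
    if_false, map_zero, mul_zero, zero_mul, and_true, and_false]
  rw [map_mul (starRingEnd ℂ), conj_stdAddChar, map_div₀, map_one, Complex.conj_ofReal, mul_mul_mul_comm,
    ← AddChar.map_add_eq_mul]
  congr 1
  · rw [div_mul_div_comm, one_mul, ← Complex.ofReal_mul, Real.mul_self_sqrt (Nat.cast_nonneg x),
      Complex.ofReal_natCast]
  · congr 1
    ring

theorem mul_sub_eq_zero_iff_mod_eq {d x y : ℕ} [NeZero d] (hxy : x * y = d) (t u : Fin d) :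
    (x : ZMod d) * (finZMod d t - finZMod d u) = 0 ↔ (t : ℕ) % y = (u : ℕ) % y := by
  have hx : (x : ℤ) ≠ 0 := by
    have := NeZero.ne d
    rintro h; simp_all
  have h1 : (x : ZMod d) * (finZMod d t - finZMod d u) =
      (((x : ℤ) * ((t : ℕ) - (u : ℕ) : ℤ) : ℤ) : ZMod d) := by
    simp [finZMod_apply]
  rw [h1, ZMod.intCast_zmod_eq_zero_iff_dvd, show (d : ℤ) = x * y by rw [← hxy, Nat.cast_mul],
    mul_dvd_mul_iff_left hx,
    ← Int.modEq_iff_dvd, eq_comm (a := (t : ℕ) % y)]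
  exact Int.natCast_modEq_iff

theorem sum_stdAddChar_natCast_mul {d x : ℕ} [NeZero d] {v : ZMod d} (h : (x : ZMod d) * v = 0) :
    ∑ s ∈ Finset.range x, ZMod.stdAddChar ((s : ZMod d) * v) = if v = 0 then (x : ℂ) else 0 := by
  split_ifs with hv
  · simp [hv]
  · have hne : (ZMod.stdAddChar v : ℂ) ≠ 1 := by
      intro h1
      exact hv (ZMod.injective_stdAddChar (h1.trans (AddChar.map_zero_eq_one _).symm))
    have hpow (s : ℕ) : (ZMod.stdAddChar ((s : ZMod d) * v) : ℂ) = ZMod.stdAddChar v ^ s := by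
      rw [← nsmul_eq_mul, AddChar.map_nsmul_eq_pow]
    simp_rw [hpow]
    rw [geom_sum_eq hne, ← hpow, h, AddChar.map_zero_eq_one, sub_self, zero_div]

theorem natCast_eq_add_mul_of_modEq_gcd {d a b : ℕ} [NeZero d] (r : ZMod d)
    (h : a % Nat.gcd r.val d = b % Nat.gcd r.val d) : ∃ k : ℤ, (a : ZMod d) = b + k * r := by
  obtain ⟨q, hq⟩ := (Int.modEq_iff_dvd.1 (Int.natCast_modEq_iff.2 (Eq.symm h : b ≡ a [MOD _])))
  refine ⟨Nat.gcdA r.val d * q, ?_⟩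
  have hg := congrArg (Int.cast : ℤ → ZMod d) (Nat.gcd_eq_gcd_ab r.val d)
  have hq' := congrArg (Int.cast : ℤ → ZMod d) hq
  push_cast at hg hq'
  rw [ZMod.natCast_self, zero_mul, add_zero, ZMod.natCast_zmod_val] at hg
  rw [hg] at hq'
  push_cast
  linear_combination hq'

theorem KD_eq_sum {d : ℕ} [NeZero d] (F : Matrix (Fin d) (Fin d) ℂ) (i j : Fin d) :
    KD F i j = (1 / d : ℂ) *
      ∑ l, F i l * ZMod.stdAddChar ((finZMod d l - finZMod d i) * finZMod d j) := by
  unfold KD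
  rw [Finset.sum_mul, Finset.mul_sum]
  refine Finset.sum_congr rfl fun l _ => ?_
  simp only [bvec, ww_pow, map_div₀, conj_stdAddChar, Complex.conj_ofReal]
  have h1 : ((finZMod d l - finZMod d i) * finZMod d j) =
      ((l * j : ℕ) : ZMod d) + -((i * j : ℕ) : ZMod d) := by
    simp only [finZMod_apply]; push_cast; ring
  have h2 : ((Real.sqrt d : ℝ) : ℂ) * (Real.sqrt d : ℝ) = d := by
    rw [← Complex.ofReal_mul, Real.mul_self_sqrt (Nat.cast_nonneg d), Complex.ofReal_natCast]
  rw [h1, AddChar.map_add_eq_mul, ← h2]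
  field_simp

/-- Fourier inversion for the Kirkwood-Dirac distribution. -/
theorem sum_KD_mul_stdAddChar {d : ℕ} [NeZero d] (F : Matrix (Fin d) (Fin d) ℂ) (i l : Fin d) :
    ∑ j, KD F i j * ZMod.stdAddChar ((finZMod d i - finZMod d l) * finZMod d j) = F i l := by
  have hd : (d : ℂ) ≠ 0 := Nat.cast_ne_zero.2 (NeZero.ne d)
  simp_rw [KD_eq_sum, Finset.mul_sum, Finset.sum_mul]
  rw [Finset.sum_comm]
  have key (k : Fin d) : ∑ j : Fin d, (1 / d : ℂ) *
      (F i k * ZMod.stdAddChar ((finZMod d k - finZMod d i) * finZMod d j)) *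
        ZMod.stdAddChar ((finZMod d i - finZMod d l) * finZMod d j) =
      if k = l then F i k else 0 := by
    have h1 (j : Fin d) : (1 / d : ℂ) *
        (F i k * ZMod.stdAddChar ((finZMod d k - finZMod d i) * finZMod d j)) *
          ZMod.stdAddChar ((finZMod d i - finZMod d l) * finZMod d j) =
        (1 / d * F i k) * ZMod.stdAddChar (finZMod d j * (finZMod d k - finZMod d l)) := by
      have : finZMod d j * (finZMod d k - finZMod d l) =
        (finZMod d k - finZMod d i) * finZMod d j + (finZMod d i - finZMod d l) * finZMod d j := by
        ring
      rw [this, AddChar.map_add_eq_mul]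
      ring
    simp_rw [h1]
    rw [← Finset.mul_sum, Equiv.sum_comp (finZMod d)
      (fun a => (ZMod.stdAddChar (a * (finZMod d k - finZMod d l)) : ℂ)),
      AddChar.sum_mulShift _ (ZMod.isPrimitive_stdAddChar d), ZMod.card]
    simp only [sub_eq_zero, (finZMod d).injective.eq_iff]
    split_ifs
    · field_simp
    · simp
  simp_rw [key]
  simp

/-- The Kirkwood-Dirac distribution of `F` is real exactly when each row of `F`, centred at the
diagonal, is conjugate-symmetric. -/
theorem KD_im_eq_zero_iff {d : ℕ} [NeZero d] (F : Matrix (Fin d) (Fin d) ℂ) :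
    (∀ i j, (KD F i j).im = 0) ↔ ∀ i l l', finZMod d l + finZMod d l' = 2 * finZMod d i →
      F i l' = (starRingEnd ℂ) (F i l) := by
  constructor
  · intro h i l l' hl
    rw [← sum_KD_mul_stdAddChar F i l, ← sum_KD_mul_stdAddChar F i l', map_sum]
    refine Finset.sum_congr rfl fun j _ => ?_
    rw [map_mul (starRingEnd ℂ), Complex.conj_eq_iff_im.2 (h i j), conj_stdAddChar]
    congr 2
    linear_combination -(finZMod d j) * hl
  · intro h i j
    rw [← Complex.conj_eq_iff_im, KD_eq_sum, map_mul, map_sum, map_div₀, map_one,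
      Complex.conj_natCast]
    congr 1
    let e : Fin d ≃ Fin d := (finZMod d).trans
      ((Equiv.subLeft (2 * finZMod d i)).trans (finZMod d).symm)
    have he (l : Fin d) : finZMod d (e l) = 2 * finZMod d i - finZMod d l := by simp [e]
    refine Fintype.sum_equiv e _ _ fun l => ?_
    rw [map_mul (starRingEnd ℂ), conj_stdAddChar, ← h i l (e l) (by rw [he]; ring), he]
    congr 2
    ring

theorem proj_isHermitian {d : ℕ} (v : Fin d → ℂ) : (proj v).IsHermitian := by
  ext i j
  simp [proj, Matrix.conjTranspose_apply, mul_comm]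

theorem KD_proj_psi_im {d x y m s : ℕ} [NeZero d] (hxy : x * y = d) (hm : m < y) (i j : Fin d) :
    (KD (proj (psi d x y m s)) i j).im = 0 := by
  revert i j
  rw [KD_im_eq_zero_iff]
  intro i l l' h
  have hmod : (l' : ℕ) % y = (i : ℕ) % y ↔ (l : ℕ) % y = (i : ℕ) % y := by
    rw [← mul_sub_eq_zero_iff_mod_eq hxy, ← mul_sub_eq_zero_iff_mod_eq hxy,
      ← neg_eq_zero (a := (x : ZMod d) * (finZMod d l - _))]
    have : (x : ZMod d) * (finZMod d l' - finZMod d i) =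
        -((x : ZMod d) * (finZMod d l - finZMod d i)) := by
      linear_combination (x : ZMod d) * h
    rw [this]
  rw [proj_psi_apply hxy hm, proj_psi_apply hxy hm]
  by_cases hi : (i : ℕ) % y = m
  · subst hi
    simp only [hmod, true_and]
    split_ifs
    · rw [map_mul (starRingEnd ℂ), conj_stdAddChar, map_div₀, map_one, Complex.conj_natCast]
      congr 2
      linear_combination -(s : ZMod d) * h
    · simp
  · simp [hi]

/-- The real subspace of self-adjoint matrices with real Kirkwood-Dirac distribution. -/
def kdReal (d : ℕ) : Submodule ℝ (Matrix (Fin d) (Fin d) ℂ) where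
  carrier := {F | F.IsHermitian ∧ ∀ i j, (KD F i j).im = 0}
  zero_mem' := ⟨Matrix.isHermitian_zero, fun i j => by simp [KD]⟩
  add_mem' := fun {F G} hF hG => ⟨hF.1.add hG.1, fun i j => by
    have : KD (F + G) i j = KD F i j + KD G i j := by
      simp [KD, add_mul, Finset.sum_add_distrib]
    rw [this, Complex.add_im, hF.2, hG.2, add_zero]⟩
  smul_mem' := fun c F hF => by
    refine ⟨?_, fun i j => ?_⟩
    · rw [Matrix.IsHermitian, Matrix.conjTranspose_smul, hF.1, star_trivial]
    · have : KD (c • F) i j = c • KD F i j := by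
        simp only [KD, Matrix.smul_apply, smul_mul_assoc, ← Finset.smul_sum]
      rw [this, Complex.smul_im, hF.2, smul_zero]

section Decomposition

variable {d : ℕ} [NeZero d] (F : Matrix (Fin d) (Fin d) ℂ)

/-- The entry of `F` in row `t` on the `r`-th cyclic diagonal. -/
def cyclicDiag (r t : ZMod d) : ℂ := F ((finZMod d).symm t) ((finZMod d).symm (t - r))

variable {F}

theorem cyclicDiag_neg (h : F ∈ kdReal d) (r t : ZMod d) :
    cyclicDiag F (-r) t = (starRingEnd ℂ) (cyclicDiag F r t) :=
  (KD_im_eq_zero_iff F).1 h.2 _ _ _ (by simp only [Equiv.apply_symm_apply]; ring)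

theorem cyclicDiag_add (h : F ∈ kdReal d) (r t : ZMod d) :
    cyclicDiag F r (t + r) = cyclicDiag F r t := by
  have h1 : cyclicDiag F (-r) t = (starRingEnd ℂ) (cyclicDiag F r (t + r)) := by
    simp only [cyclicDiag, sub_neg_eq_add, add_sub_cancel_right]
    exact (h.1.apply _ _).symm
  rw [cyclicDiag_neg h] at h1
  exact ((starRingEnd ℂ).injective h1).symm

theorem cyclicDiag_add_intCast_mul (h : F ∈ kdReal d) (r t : ZMod d) (k : ℤ) :
    cyclicDiag F r (t + k * r) = cyclicDiag F r t := by
  induction k using Int.induction_on with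
  | zero => simp
  | succ k ih =>
    rw [← ih, ← cyclicDiag_add h r (t + (k : ℤ) * r)]
    congr 1
    push_cast
    ring
  | pred k ih =>
    rw [← ih, ← cyclicDiag_add h r (t + _)]
    congr 1
    push_cast
    ring

theorem eq_sum_proj_psi (h : F ∈ kdReal d) :
    F = ∑ r : ZMod d, ∑ m ∈ Finset.range (Nat.gcd r.val d),
      ∑ s ∈ Finset.range (d / Nat.gcd r.val d),
        (cyclicDiag F r m * ZMod.stdAddChar (-(s * r) : ZMod d)).re •
          proj (psi d (d / Nat.gcd r.val d) (Nat.gcd r.val d) m s) := by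
  ext t u
  simp only [Matrix.sum_apply, Matrix.smul_apply]
  have hd : 0 < d := Nat.pos_of_ne_zero (NeZero.ne d)
  set v : ZMod d := finZMod d t - finZMod d u with hv
  have key (r : ZMod d) : ∑ m ∈ Finset.range (Nat.gcd r.val d),
      ∑ s ∈ Finset.range (d / Nat.gcd r.val d),
        (cyclicDiag F r m * ZMod.stdAddChar (-(s * r) : ZMod d)).re •
          proj (psi d (d / Nat.gcd r.val d) (Nat.gcd r.val d) m s) t u =
      (if v = r then cyclicDiag F r (finZMod d t) / 2 else 0) +
        (if v = -r then (starRingEnd ℂ) (cyclicDiag F r (finZMod d t)) / 2 else 0) := by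
    set y := Nat.gcd r.val d with hy
    set x := d / y with hx
    have hy0 : 0 < y := Nat.gcd_pos_of_pos_right _ hd
    have hxy : x * y = d := Nat.div_mul_cancel (Nat.gcd_dvd_right _ _)
    have hx0 : (x : ℂ) ≠ 0 := by
      rw [Nat.cast_ne_zero]; rintro h0; rw [h0] at hxy; omega
    have hxr : (x : ZMod d) * r = 0 := by
      obtain ⟨q, hq⟩ : y ∣ r.val := Nat.gcd_dvd_left _ _
      rw [← ZMod.natCast_zmod_val r, hq, Nat.cast_mul, ← mul_assoc, ← Nat.cast_mul, hxy,
        ZMod.natCast_self, zero_mul]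
    rw [Finset.sum_eq_single ((t : ℕ) % y)]
    rotate_left
    · intro m hm hne
      refine Finset.sum_eq_zero fun s _ => ?_
      rw [proj_psi_apply hxy (Finset.mem_range.1 hm), if_neg (fun h' => hne h'.1.symm), smul_zero]
    · intro hm
      exact absurd (Finset.mem_range.2 (Nat.mod_lt _ hy0)) hm
    simp_rw [proj_psi_apply hxy (Nat.mod_lt _ hy0)]
    obtain ⟨k, hk⟩ := natCast_eq_add_mul_of_modEq_gcd (d := d) (a := t % y) (b := t) r
      (Nat.mod_mod _ _)
    have hG : cyclicDiag F r ((t % y : ℕ) : ZMod d) = cyclicDiag F r (finZMod d t) := by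
      rw [hk, cyclicDiag_add_intCast_mul h]; rfl
    rw [hG, ← hv]
    set g := cyclicDiag F r (finZMod d t)
    by_cases hmod : (u : ℕ) % y = (t : ℕ) % y
    · have hxv : (x : ZMod d) * v = 0 := (mul_sub_eq_zero_iff_mod_eq hxy t u).2 hmod.symm
      have hterm (s : ℕ) : (g * ZMod.stdAddChar (-(s * r) : ZMod d)).re •
          ((1 / x : ℂ) * ZMod.stdAddChar (s * v : ZMod d)) =
          g / (2 * x) * ZMod.stdAddChar (s * (v - r) : ZMod d) +
            (starRingEnd ℂ) g / (2 * x) * ZMod.stdAddChar (s * (v + r) : ZMod d) := by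
        have e1 : (s * (v - r) : ZMod d) = s * v + -(s * r) := by ring
        rw [Complex.real_smul, Complex.re_eq_add_conj, map_mul, conj_stdAddChar, neg_neg, e1,
          mul_add, AddChar.map_add_eq_mul, AddChar.map_add_eq_mul]
        field_simp
      simp only [hmod, and_self, if_true, hterm, Finset.sum_add_distrib, ← Finset.mul_sum]
      rw [sum_stdAddChar_natCast_mul (by rw [mul_sub, hxv, hxr, sub_zero]),
        sum_stdAddChar_natCast_mul (by rw [mul_add, hxv, hxr, add_zero])]
      simp only [sub_eq_zero, ← eq_neg_iff_add_eq_zero, mul_ite, mul_zero]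
      congr 2 <;> field_simp
    · have hxv : (x : ZMod d) * v ≠ 0 := fun h' =>
        hmod ((mul_sub_eq_zero_iff_mod_eq hxy t u).1 h').symm
      rw [if_neg (by rintro rfl; exact hxv hxr),
        if_neg (by intro h'; rw [h', mul_neg, hxr, neg_zero] at hxv; exact hxv rfl)]
      simp [hmod]
  simp_rw [key, Finset.sum_add_distrib, ← neg_eq_iff_eq_neg]
  rw [Finset.sum_ite_eq, Finset.sum_ite_eq, if_pos (Finset.mem_univ _),
    if_pos (Finset.mem_univ _), cyclicDiag_neg h, Complex.conj_conj, add_halves]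
  simp [cyclicDiag, hv]

end Decomposition

/-- Lemma on KD-real operators: for any dimension d, the set of self-adjoint
    operators whose KD distribution is real equals the real span of the KD-classical
    pure-state projections. -/
theorem kd_real_eq_span (d : ℕ) (hd : 0 < d) :
    {F : Matrix (Fin d) (Fin d) ℂ | F.IsHermitian ∧ ∀ i j, (KD F i j).im = 0}
    = (Submodule.span ℝ (pureKD d) : Set (Matrix (Fin d) (Fin d) ℂ)) := by
  have : NeZero d := ⟨hd.ne'⟩
  change (kdReal d : Set (Matrix (Fin d) (Fin d) ℂ)) = _
  congr 1
  apply le_antisymm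
  · intro F hF
    rw [eq_sum_proj_psi hF]
    refine Submodule.sum_mem _ fun r _ => Submodule.sum_mem _ fun m hm =>
      Submodule.sum_mem _ fun s hs => Submodule.smul_mem _ _ (Submodule.subset_span ?_)
    exact ⟨_, _, m, s, Nat.div_mul_cancel (Nat.gcd_dvd_right _ _), Finset.mem_range.1 hm,
      Finset.mem_range.1 hs, rfl⟩
  · rw [Submodule.span_le]
    rintro _ ⟨x, y, m, s, hxy, hm, -, rfl⟩
    exact ⟨proj_isHermitian _, KD_proj_psi_im hxy hm⟩
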